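/- arXiv:math/9702203 — 2 statements merged into one kernel-verified Lean document; each statement's English description precedes it below -/
import Mathlib

section
/- For all natural numbers a, b ≥ 0 and c > 0, the element x^a y^b (y^t)^c of H has ℓ(x^a y^b (y^t)^c) = a + b + c + 2, where y^t = t⁻¹ y t; in particular the word x^a y^b t y^c t is geodesic for this element. -/
/-! Generators and presentations for the groups `H` and `G` of Neumann–Shapiro. -/

inductive GenH : Type
  | x | y | t | tau
  deriving DecidableEq

inductive GenG : Type
  | x | y | s | t
  deriving DecidableEq

namespace NS

open FreeGroup

/-- Conjugation `a^b = b⁻¹ a b` in a group. -/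
def cnj {Γ : Type*} [Group Γ] (a b : Γ) : Γ := b⁻¹ * a * b

/-! ### The group `H` -/

abbrev FH := FreeGroup GenH

def fx : FH := FreeGroup.of GenH.x
def fy : FH := FreeGroup.of GenH.y
def ft : FH := FreeGroup.of GenH.t
def ftau : FH := FreeGroup.of GenH.tau

/-- The eight elements `x, x^t, x^τ, x^{tτ}, y, y^t, y^τ, y^{tτ}` (as words). -/
def basisH : List FH :=
  [fx, cnj fx ft, cnj fx ftau, cnj fx (ft * ftau),
   fy, cnj fy ft, cnj fy ftau, cnj fy (ft * ftau)]

/-- Relators of `H`: `t² = τ² = [τ,t] = 1`, the eight elements of `basisH` pairwise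
commute, and `x · x^τ = y · y^t`. -/
def relsH : Set FH :=
  {ft ^ 2, ftau ^ 2, ftau⁻¹ * ft⁻¹ * ftau * ft} ∪
    {r | ∃ a ∈ basisH, ∃ b ∈ basisH, r = a * b * a⁻¹ * b⁻¹} ∪
    {fx * cnj fx ftau * (fy * cnj fy ft)⁻¹}

abbrev H := PresentedGroup relsH

def Hx : H := PresentedGroup.of GenH.x
def Hy : H := PresentedGroup.of GenH.y
def Ht : H := PresentedGroup.of GenH.t
def Htau : H := PresentedGroup.of GenH.tau

/-! ### The group `G` -/

abbrev FG := FreeGroup GenG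

def gx : FG := FreeGroup.of GenG.x
def gy : FG := FreeGroup.of GenG.y
def gs : FG := FreeGroup.of GenG.s
def gt : FG := FreeGroup.of GenG.t

/-- The eight conjugating elements `1, s, s², s³, t, ts, ts², ts³`. -/
def conjsG : List FG := [1, gs, gs ^ 2, gs ^ 3, gt, gt * gs, gt * gs ^ 2, gt * gs ^ 3]

/-- The sixteen elements `x^α, y^α` for `α ∈ {1, s, s², s³, t, ts, ts², ts³}`. -/
def basisG : List FG :=
  conjsG.map (fun b => cnj gx b) ++ conjsG.map (fun b => cnj gy b)

/-- Relators of `G`: `t² = s⁴ = [s,t] = 1`, the sixteen elements of `basisG` pairwise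
commute, and `x · x^{s²} = y · y^t`. -/
def relsG : Set FG :=
  {gt ^ 2, gs ^ 4, gs⁻¹ * gt⁻¹ * gs * gt} ∪
    {r | ∃ a ∈ basisG, ∃ b ∈ basisG, r = a * b * a⁻¹ * b⁻¹} ∪
    {gx * cnj gx (gs ^ 2) * (gy * cnj gy gt)⁻¹}

abbrev G := PresentedGroup relsG

def Gx : G := PresentedGroup.of GenG.x
def Gy : G := PresentedGroup.of GenG.y
def Gs : G := PresentedGroup.of GenG.s
def Gt : G := PresentedGroup.of GenG.t

/-! ### Words, evaluation, lengths, geodesics -/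

/-- A word over the symmetric alphabet on `α`: a letter `(a, true)` stands for the
generator `a` and `(a, false)` for its inverse. -/
abbrev Word (α : Type) := List (α × Bool)

/-- Evaluate a word in a group, given the images of the generators. -/
def evalWith {α : Type} {Γ : Type*} [Group Γ] (f : α → Γ) (w : Word α) : Γ :=
  (w.map fun p => if p.2 then f p.1 else (f p.1)⁻¹).prod

/-- Evaluation of a word over `X_H = {x^{±1}, y^{±1}, t^{±1}, τ^{±1}}` in `H`. -/
def evalH : Word GenH → H := evalWith (fun a => (PresentedGroup.of a : H))

/-- Evaluation of a word over `X = {x^{±1}, y^{±1}, t^{±1}, s^{±1}}` in `G`. -/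
def evalG : Word GenG → G := evalWith (fun a => (PresentedGroup.of a : G))

/-- Weight of a letter for `H`: the letters `x^{±1}, y^{±1}, t^{±1}` have length `1`
and `τ^{±1}` has length `2`. -/
def wtH : GenH × Bool → ℕ
  | (GenH.tau, _) => 2
  | _ => 1

/-- Weighted length of a word over `X_H`. -/
def wlenH (w : Word GenH) : ℕ := (w.map wtH).sum

/-- `ℓ(h)`: the minimum weighted length of a word over `X_H` evaluating to `h`. -/
noncomputable def ellH (h : H) : ℕ := sInf {n | ∃ w : Word GenH, evalH w = h ∧ wlenH w = n}

/-- A word over `X_H` is geodesic if its weighted length is `ℓ` of its evaluation. -/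
def IsGeodesicH (w : Word GenH) : Prop := wlenH w = ellH (evalH w)

/-- `ℓ_G(g)`: the minimum length (number of letters) of a word over `X` evaluating to `g`. -/
noncomputable def ellG (g : G) : ℕ := sInf {n | ∃ w : Word GenG, evalG w = g ∧ w.length = n}

/-- A word over `X` is geodesic if its length is `ℓ_G` of its evaluation. -/
def IsGeodesicG (w : Word GenG) : Prop := w.length = ellG (evalG w)

end NS

namespace NS

/-- Translation of the two copies of `ℤ` in `Bool × ℤ` by the two values of `u`. -/
def shift (u : Bool → ℤ) : Equiv.Perm (Bool × ℤ) where
  toFun p := (p.1, p.2 + u p.1)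
  invFun p := (p.1, p.2 - u p.1)
  left_inv p := by simp
  right_inv p := by simp

/-- Exchange of the two copies of `ℤ` in `Bool × ℤ`. -/
def swapSheets : Equiv.Perm (Bool × ℤ) := Equiv.prodCongr Equiv.boolNot (Equiv.refl ℤ)

/-- Translation by one on the `false` copy of `ℤ`. -/
def unitShift : Equiv.Perm (Bool × ℤ) := shift fun b => if b then 0 else 1

lemma shift_commute (u v : Bool → ℤ) : Commute (shift u) (shift v) := by
  ext p <;> simp [shift, add_right_comm]

@[simp] lemma shift_apply (u : Bool → ℤ) (b : Bool) (n : ℤ) :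
    shift u (b, n) = (b, n + u b) := rfl

@[simp] lemma shift_symm_apply (u : Bool → ℤ) (b : Bool) (n : ℤ) :
    (shift u).symm (b, n) = (b, n - u b) := rfl

@[simp] lemma swapSheets_apply (b : Bool) (n : ℤ) : swapSheets (b, n) = (!b, n) := rfl

@[simp] lemma swapSheets_inv : swapSheets⁻¹ = swapSheets := rfl

@[simp] lemma swapSheets_mul_self : swapSheets * swapSheets = 1 := by
  ext p <;> simp [swapSheets]

lemma cnj_shift_swapSheets (u : Bool → ℤ) :
    cnj (shift u) swapSheets = shift fun b => u !b := by
  ext ⟨b, n⟩ <;> simp [cnj]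

/-- Images of the generators of `H` in `ℤ ≀ ℤ/2`, acting on `Bool × ℤ`. -/
def sheetGen : GenH → Equiv.Perm (Bool × ℤ)
  | .x => unitShift
  | .y => unitShift
  | .t => swapSheets
  | .tau => swapSheets

lemma lift_basisH {a : FH} (ha : a ∈ basisH) :
    ∃ u, FreeGroup.lift sheetGen a = shift u := by
  have h : cnj unitShift swapSheets = _ := cnj_shift_swapSheets _
  simp only [cnj, swapSheets_inv] at h
  simp only [basisH, List.mem_cons, List.not_mem_nil, or_false] at ha
  rcases ha with rfl | rfl | rfl | rfl | rfl | rfl | rfl | rfl <;>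
    simp [fx, fy, ft, ftau, cnj, sheetGen, h] <;> exact ⟨_, rfl⟩

lemma lift_relsH : ∀ r ∈ relsH, FreeGroup.lift sheetGen r = 1 := by
  rintro r ((h | ⟨a, ha, b, hb, rfl⟩) | rfl)
  · rcases h with rfl | rfl | rfl <;> simp [ft, ftau, sheetGen, sq]
  · obtain ⟨u, hu⟩ := lift_basisH ha
    obtain ⟨v, hv⟩ := lift_basisH hb
    simp [hu, hv, (shift_commute u v).eq]
  · rw [map_mul, map_inv, mul_inv_eq_one]
    simp [fx, fy, ft, ftau, cnj, sheetGen]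

/-- The action of `H` on `Bool × ℤ` through its quotient `ℤ ≀ ℤ/2`. -/
def sheetHom : H →* Equiv.Perm (Bool × ℤ) := PresentedGroup.toGroup lift_relsH

@[simp] lemma sheetHom_of (g : GenH) :
    sheetHom (PresentedGroup.of g : H) = sheetGen g := PresentedGroup.toGroup.of _

lemma evalH_cons (p : GenH × Bool) (w : Word GenH) :
    evalH (p :: w) = (if p.2 then (PresentedGroup.of p.1 : H) else (PresentedGroup.of p.1)⁻¹) *
      evalH w := by
  simp [evalH, evalWith]

/-- Here `k` is the number of letters `t^{±1}`, `τ^{±1}` in the word. -/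
lemma sheetHom_evalH (w : Word GenH) :
    ∃ (u : Bool → ℤ) (k : ℕ),
      (∀ b n, sheetHom (evalH w) (b, n) = (b ^^ k.bodd, n + u b)) ∧
      u false + u true + k ≤ wlenH w ∧ (k = 0 → u true = 0) := by
  induction w with
  | nil => exact ⟨0, 0, by simp [evalH, evalWith], by simp [wlenH], by simp⟩
  | cons p w ih =>
    obtain ⟨u, k, hu, hle, hk⟩ := ih
    have hlen : wlenH (p :: w) = wtH p + wlenH w := by simp [wlenH]
    have hshift (e : ℤ) (he : e ≤ 1) (hp : wtH p = 1)
        (hmap : ∀ b n, sheetHom (evalH (p :: w)) (b, n) =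
          (b ^^ k.bodd, n + (u b + if b ^^ k.bodd then 0 else e))) :
        ∃ (u : Bool → ℤ) (k : ℕ),
          (∀ b n, sheetHom (evalH (p :: w)) (b, n) = (b ^^ k.bodd, n + u b)) ∧
          u false + u true + k ≤ wlenH (p :: w) ∧ (k = 0 → u true = 0) := by
      refine ⟨fun b => u b + if b ^^ k.bodd then 0 else e, k, hmap, ?_, ?_⟩
      · rw [hlen, hp]
        cases k.bodd <;> simp <;> omega
      · rintro rfl
        simp [hk]
    have hswap (hp : 1 ≤ wtH p)
        (hmap : ∀ b n, sheetHom (evalH (p :: w)) (b, n) = (!(b ^^ k.bodd), n + u b)) :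
        ∃ (u : Bool → ℤ) (k : ℕ),
          (∀ b n, sheetHom (evalH (p :: w)) (b, n) = (b ^^ k.bodd, n + u b)) ∧
          u false + u true + k ≤ wlenH (p :: w) ∧ (k = 0 → u true = 0) := by
      refine ⟨u, k + 1, by simpa using hmap, ?_, by simp⟩
      rw [hlen]
      push_cast
      omega
    obtain ⟨g, s⟩ := p
    cases g
    case x | y =>
      cases s
      · exact hshift (-1) (by simp) rfl fun b n => by
          cases b <;> cases h : k.bodd <;>
            simp [evalH_cons, sheetGen, hu, unitShift, h] <;> ring
      · exact hshift 1 le_rfl rfl fun b n => by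
          cases b <;> cases h : k.bodd <;>
            simp [evalH_cons, sheetGen, hu, unitShift, h] <;> ring
    case t | tau =>
      exact hswap (by simp [wtH]) fun b n => by cases s <;> simp [evalH_cons, sheetGen, hu]

lemma shift_pow_apply (u : Bool → ℤ) (m : ℕ) (b : Bool) (n : ℤ) :
    (shift u ^ m) (b, n) = (b, n + m * u b) := by
  induction m with
  | zero => simp
  | succ m ih =>
    rw [pow_succ', Equiv.Perm.mul_apply, ih, shift_apply]
    push_cast
    ring_nf

lemma sheetHom_xa_yb_ytc (a b c : ℕ) (s : Bool) (n : ℤ) :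
    sheetHom (Hx ^ a * Hy ^ b * (cnj Hy Ht) ^ c) (s, n) =
      (s, n + if s then (c : ℤ) else a + b) := by
  have h : sheetHom (cnj Hy Ht) = cnj unitShift swapSheets := by
    simp [cnj, Hy, Ht, sheetGen]
  rw [map_mul, map_mul, map_pow, map_pow, map_pow, h, unitShift, cnj_shift_swapSheets,
    Equiv.Perm.mul_apply, Equiv.Perm.mul_apply, shift_pow_apply]
  cases s <;> simp [Hx, Hy, sheetGen, unitShift, shift_pow_apply]; ring

lemma le_wlenH {a b c : ℕ} (hc : 0 < c) {w : Word GenH}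
    (hw : evalH w = Hx ^ a * Hy ^ b * (cnj Hy Ht) ^ c) : a + b + c + 2 ≤ wlenH w := by
  obtain ⟨u, k, hu, hle, hk⟩ := sheetHom_evalH w
  simp only [hw, sheetHom_xa_yb_ytc, Prod.mk.injEq, add_right_inj] at hu
  have hf := hu false 0
  have ht := hu true 0
  simp only [Bool.false_eq_true, if_false, if_true, Bool.false_bne] at hf ht
  have hk0 : k ≠ 0 := fun h => by have := hk h; omega
  have hk1 : k ≠ 1 := by rintro rfl; simp at hf
  omega

lemma Ht_inv : Ht⁻¹ = Ht := by
  have h : (PresentedGroup.mk relsH (ft ^ 2) : H) = 1 :=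
    PresentedGroup.one_of_mem (by simp [relsH])
  rw [inv_eq_iff_mul_eq_one, ← sq]
  exact h

lemma evalH_xa_yb_t_yc_t (a b c : ℕ) :
    evalH (List.replicate a (GenH.x, true) ++ List.replicate b (GenH.y, true) ++
        [(GenH.t, true)] ++ List.replicate c (GenH.y, true) ++ [(GenH.t, true)]) =
      Hx ^ a * Hy ^ b * (cnj Hy Ht) ^ c := by
  have h : (cnj Hy Ht) ^ c = Ht * Hy ^ c * Ht := by
    rw [cnj, Ht_inv]
    have := conj_pow (a := Ht⁻¹) (b := Hy) (i := c)
    rwa [inv_inv, Ht_inv] at this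
  rw [h]
  simp [evalH, evalWith, Hx, Hy, Ht, mul_assoc]

end NS

open NS in
/-- For `a, b ≥ 0` and `c > 0`, the element `x^a y^b (y^t)^c` of `H` has
`ℓ(x^a y^b (y^t)^c) = a + b + c + 2`; in particular the word `x^a y^b t y^c t`
evaluates to this element and is geodesic. -/
theorem ell_xa_yb_ytc (a b c : ℕ) (hc : 0 < c) :
    ellH (Hx ^ a * Hy ^ b * (cnj Hy Ht) ^ c) = a + b + c + 2 ∧
    evalH (List.replicate a (GenH.x, true) ++ List.replicate b (GenH.y, true) ++
        [(GenH.t, true)] ++ List.replicate c (GenH.y, true) ++ [(GenH.t, true)]) =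
      Hx ^ a * Hy ^ b * (cnj Hy Ht) ^ c ∧
    IsGeodesicH (List.replicate a (GenH.x, true) ++ List.replicate b (GenH.y, true) ++
        [(GenH.t, true)] ++ List.replicate c (GenH.y, true) ++ [(GenH.t, true)]) := by
  have hle : wlenH (List.replicate a (GenH.x, true) ++ List.replicate b (GenH.y, true) ++
      [(GenH.t, true)] ++ List.replicate c (GenH.y, true) ++ [(GenH.t, true)]) =
      a + b + c + 2 := by
    simp [wlenH, wtH]
    ring
  have heval := evalH_xa_yb_t_yc_t a b c
  have hell : ellH (Hx ^ a * Hy ^ b * (cnj Hy Ht) ^ c) = a + b + c + 2 := by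
    refine IsLeast.csInf_eq ⟨⟨_, heval, hle⟩, ?_⟩
    rintro _ ⟨w, hw, rfl⟩
    exact le_wlenH hc hw
  exact ⟨hell, heval, by rw [IsGeodesicH, heval, hell, hle]⟩
end

section
/- For all natural numbers d, e, f with e > d ≥ 0, the element x^d (x^τ)^e y^f of H (where x^τ = τ⁻¹xτ) satisfies ℓ(x^d (x^τ)^e y^f) = d + e + f + 4. -/
namespace NS

/-! ### An action of `H` detecting lengths -/

/-- The fibrewise translation of `B × Z` by `v`. -/
def fiberTranslate {B Z : Type*} [AddGroup Z] (v : B → Z) : Equiv.Perm (B × Z) :=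
  (Equiv.refl B).prodShear fun b => Equiv.addRight (v b)

/-- The permutation of `B × Z` acting as `σ` on the base. -/
def basePerm {B Z : Type*} (σ : Equiv.Perm B) : Equiv.Perm (B × Z) :=
  σ.prodCongr (Equiv.refl Z)

@[simp]
theorem fiberTranslate_apply {B Z : Type*} [AddGroup Z] (v : B → Z) (p : B × Z) :
    fiberTranslate v p = (p.1, p.2 + v p.1) := rfl

@[simp]
theorem basePerm_apply {B Z : Type*} (σ : Equiv.Perm B) (p : B × Z) :
    basePerm σ p = (σ p.1, p.2) := rfl

@[simp]
theorem fiberTranslate_inv_apply {B Z : Type*} [AddGroup Z] (v : B → Z) (p : B × Z) :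
    (fiberTranslate v)⁻¹ p = (p.1, p.2 - v p.1) := by
  rw [Equiv.Perm.inv_eq_iff_eq]
  simp

@[simp]
theorem basePerm_inv {B Z : Type*} (σ : Equiv.Perm B) :
    (basePerm σ : Equiv.Perm (B × Z))⁻¹ = basePerm σ⁻¹ := rfl

theorem basePerm_mul {B Z : Type*} (σ ρ : Equiv.Perm B) :
    (basePerm σ * basePerm ρ : Equiv.Perm (B × Z)) = basePerm (σ * ρ) := rfl

theorem basePerm_one {B Z : Type*} : (basePerm 1 : Equiv.Perm (B × Z)) = 1 := rfl

theorem fiberTranslate_mul {B Z : Type*} [AddCommGroup Z] (v w : B → Z) :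
    fiberTranslate v * fiberTranslate w = fiberTranslate (v + w) := by
  ext p : 1
  simp [add_assoc, add_comm (w p.1)]

theorem fiberTranslate_pow {B Z : Type*} [AddCommGroup Z] (v : B → Z) (n : ℕ) :
    fiberTranslate v ^ n = fiberTranslate (n • v) := by
  induction n with
  | zero => ext p : 1; simp
  | succ n ih => rw [pow_succ, ih, fiberTranslate_mul, succ_nsmul]

theorem cnj_fiberTranslate_basePerm {B Z : Type*} [AddGroup Z] (v : B → Z)
    (σ : Equiv.Perm B) :
    cnj (fiberTranslate v) (basePerm σ) = fiberTranslate (v ∘ σ) := by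
  ext p : 1
  simp [cnj]

/-- The base permutation flipping the coordinate of `t`. -/
def flipT : Equiv.Perm (Bool × Bool) := (Equiv.refl Bool).prodCongr Equiv.boolNot

/-- The base permutation flipping the coordinate of `τ`. -/
def flipTau : Equiv.Perm (Bool × Bool) := Equiv.boolNot.prodCongr (Equiv.refl Bool)

@[simp]
theorem flipT_apply (b : Bool × Bool) : flipT b = (b.1, !b.2) := rfl

@[simp]
theorem flipTau_apply (b : Bool × Bool) : flipTau b = (!b.1, b.2) := rfl

/-- The translation by which `x` acts over a point of the base. -/
def shiftX (b : Bool × Bool) : ℤ × ℤ × ℤ := (if b.1 then 3 else -1, 1, 1)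

/-- The translation by which `y` acts over a point of the base. -/
def shiftY (b : Bool × Bool) : ℤ × ℤ × ℤ := (1, if b.2 then 0 else 2, 1)

/-- The permutations by which the generators of `H` act. -/
def genPerm : GenH → Equiv.Perm ((Bool × Bool) × (ℤ × ℤ × ℤ))
  | GenH.x => fiberTranslate shiftX
  | GenH.y => fiberTranslate shiftY
  | GenH.t => basePerm flipT
  | GenH.tau => basePerm flipTau

theorem map_cnj {Γ Δ : Type*} [Group Γ] [Group Δ] (φ : Γ →* Δ) (a b : Γ) :
    φ (cnj a b) = cnj (φ a) (φ b) := by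
  simp [cnj]

theorem exists_lift_genPerm_eq_fiberTranslate {a : FH} (ha : a ∈ basisH) :
    ∃ v, FreeGroup.lift genPerm a = fiberTranslate v := by
  simp only [basisH, List.mem_cons, List.not_mem_nil, or_false] at ha
  rcases ha with rfl | rfl | rfl | rfl | rfl | rfl | rfl | rfl <;>
    simp only [map_cnj, map_mul, fx, fy, ft, ftau, FreeGroup.lift_apply_of, genPerm,
      basePerm_mul, cnj_fiberTranslate_basePerm] <;>
    exact ⟨_, rfl⟩

theorem lift_genPerm_eq_one_of_mem_relsH {r : FH} (hr : r ∈ relsH) :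
    FreeGroup.lift genPerm r = 1 := by
  rcases hr with (hr | ⟨a, ha, b, hb, rfl⟩) | rfl
  · rcases hr with rfl | rfl | rfl <;>
      simp only [map_mul, map_inv, ft, ftau, FreeGroup.lift_apply_of, genPerm,
        basePerm_inv, pow_two, basePerm_mul] <;>
      rw [← basePerm_one] <;> congr 1 <;> decide
  · obtain ⟨v, hv⟩ := exists_lift_genPerm_eq_fiberTranslate ha
    obtain ⟨w, hw⟩ := exists_lift_genPerm_eq_fiberTranslate hb
    rw [map_mul, map_mul, map_mul, map_inv, map_inv, hv, hw, fiberTranslate_mul, add_comm,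
      ← fiberTranslate_mul, mul_inv_cancel_right, mul_inv_cancel]
  · simp only [map_mul, map_inv, map_cnj, fx, fy, ft, ftau, FreeGroup.lift_apply_of, genPerm,
      cnj_fiberTranslate_basePerm, fiberTranslate_mul]
    rw [mul_inv_eq_one]
    congr 1
    decide

/-- The action of `H` on `(Bool × Bool) × ℤ³` given by `genPerm`. -/
def permRep : H →* Equiv.Perm ((Bool × Bool) × (ℤ × ℤ × ℤ)) :=
  PresentedGroup.toGroup fun _ => lift_genPerm_eq_one_of_mem_relsH

@[simp]
theorem permRep_of (a : GenH) : permRep (PresentedGroup.of a) = genPerm a :=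
  PresentedGroup.toGroup.of _

/-- The base point moved by the action of `h`. -/
def orbitPoint (h : H) : (Bool × Bool) × (ℤ × ℤ × ℤ) := permRep h ((false, false), 0)

theorem orbitPoint_xd_xtaue_yf (d e f : ℕ) :
    orbitPoint (Hx ^ d * (cnj Hx Htau) ^ e * Hy ^ f) =
      ((false, false), (3 * e - d + f : ℤ), (d + e + 2 * f : ℤ), (d + e + f : ℤ)) := by
  simp only [orbitPoint, map_mul, map_pow, map_cnj, Hx, Hy, Htau, permRep_of, genPerm,
    cnj_fiberTranslate_basePerm, fiberTranslate_pow, fiberTranslate_mul, fiberTranslate_apply]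
  ext <;> simp [shiftX, shiftY] <;> ring

@[simp]
theorem evalWith_cons {α : Type} {Γ : Type*} [Group Γ] (f : α → Γ) (p : α × Bool)
    (w : Word α) :
    evalWith f (p :: w) = (if p.2 then f p.1 else (f p.1)⁻¹) * evalWith f w := by
  simp [evalWith]

@[simp]
theorem evalWith_append {α : Type} {Γ : Type*} [Group Γ] (f : α → Γ) (v w : Word α) :
    evalWith f (v ++ w) = evalWith f v * evalWith f w := by
  simp [evalWith]

@[simp]
theorem evalWith_replicate {α : Type} {Γ : Type*} [Group Γ] (f : α → Γ) (n : ℕ) (a : α) :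
    evalWith f (List.replicate n (a, true)) = f a ^ n := by
  simp [evalWith]

/-- The numbers `n` of letters `x^{±1}, y^{±1}`, `k` of letters `t^{±1}` and `m` of letters
`τ^{±1}` in a word constrain the orbit point of its value. -/
theorem exists_letter_counts (w : Word GenH) :
    ∃ n k m : ℕ, wlenH w = n + k + 2 * m ∧
      ((orbitPoint (evalH w)).1.1 = true ↔ m % 2 = 1) ∧
      ((orbitPoint (evalH w)).1.2 = true ↔ k % 2 = 1) ∧
      |(orbitPoint (evalH w)).2.2.2| ≤ n ∧
      (m = 0 → |(orbitPoint (evalH w)).2.1| ≤ n) ∧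
      (m = 0 → k = 0 → 2 * (orbitPoint (evalH w)).2.2.1 =
        3 * (orbitPoint (evalH w)).2.2.2 + (orbitPoint (evalH w)).2.1) := by
  induction w with
  | nil => exact ⟨0, 0, 0, by simp [wlenH, orbitPoint, evalH, evalWith]⟩
  | cons p w ih =>
    obtain ⟨n, k, m, hlen, hτ, ht, hs, hp, hq⟩ := ih
    have hstep : orbitPoint (evalH (p :: w)) =
        (if p.2 then genPerm p.1 else (genPerm p.1)⁻¹) (orbitPoint (evalH w)) := by
      rcases p with ⟨a, _ | _⟩ <;> simp [orbitPoint, evalH]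
    have hw : wlenH (p :: w) = wtH p + wlenH w := by simp [wlenH]
    rw [hstep, hw, hlen]
    generalize orbitPoint (evalH w) = o at *
    obtain ⟨⟨bτ, bt⟩, u, v, s⟩ := o
    simp only [abs_le] at *
    obtain ⟨a, ε⟩ := p
    cases a
    · refine ⟨n + 1, k, m, by simp only [wtH]; omega, ?_⟩
      cases ε <;> cases bτ <;> simp [genPerm, shiftX] at * <;> grind
    · refine ⟨n + 1, k, m, by simp only [wtH]; omega, ?_⟩
      cases ε <;> cases bt <;> simp [genPerm, shiftY] at * <;> grind
    · refine ⟨n, k + 1, m, by simp only [wtH]; omega, ?_⟩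
      have : flipT⁻¹ = flipT := by decide
      cases ε <;> cases bt <;> simp [genPerm, this] at * <;> grind
    · refine ⟨n, k, m + 1, by simp only [wtH]; omega, ?_⟩
      have : flipTau⁻¹ = flipTau := by decide
      cases ε <;> cases bτ <;> simp [genPerm, this] at * <;> grind

theorem ellH_le_wlenH (w : Word GenH) : ellH (evalH w) ≤ wlenH w :=
  Nat.sInf_le ⟨w, rfl, rfl⟩

/-- A word for `x^d (x^τ)^e y^f` of weighted length `d + e + f + 4`. -/
def wordXXtauY (d e f : ℕ) : Word GenH :=
  List.replicate d (GenH.x, true) ++ (GenH.tau, false) :: List.replicate e (GenH.x, true) ++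
    (GenH.tau, true) :: List.replicate f (GenH.y, true)

theorem evalH_wordXXtauY (d e f : ℕ) :
    evalH (wordXXtauY d e f) = Hx ^ d * (cnj Hx Htau) ^ e * Hy ^ f := by
  have hc : (cnj Hx Htau) ^ e = Htau⁻¹ * Hx ^ e * Htau := by
    simpa [cnj] using conj_pow (a := Htau⁻¹) (b := Hx) (i := e)
  rw [hc]
  simp [wordXXtauY, evalH, Hx, Hy, Htau, mul_assoc]

theorem wlenH_wordXXtauY (d e f : ℕ) : wlenH (wordXXtauY d e f) = d + e + f + 4 := by
  simp [wordXXtauY, wlenH, wtH]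
  ring

theorem le_wlenH_of_evalH_eq {d e f : ℕ} (hde : d < e) {w : Word GenH}
    (hw : evalH w = Hx ^ d * (cnj Hx Htau) ^ e * Hy ^ f) : d + e + f + 4 ≤ wlenH w := by
  obtain ⟨n, k, m, hlen, hτ, ht, hs, hp, hq⟩ := exists_letter_counts w
  rw [hw, orbitPoint_xd_xtaue_yf] at hτ ht hs hp hq
  simp only [abs_le, Bool.false_eq_true, false_iff] at hτ ht hs hp hq
  omega

end NS

open NS in
/-- For natural numbers `d, e, f` with `e > d ≥ 0`,
`ℓ(x^d (x^τ)^e y^f) = d + e + f + 4`. -/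
theorem ell_xd_xtaue_yf_of_gt (d e f : ℕ) (hde : d < e) :
    ellH (Hx ^ d * (cnj Hx Htau) ^ e * Hy ^ f) = d + e + f + 4 := by
  apply le_antisymm
  · rw [← evalH_wordXXtauY, ← wlenH_wordXXtauY]
    exact ellH_le_wlenH _
  · refine le_csInf ⟨_, wordXXtauY d e f, evalH_wordXXtauY d e f, rfl⟩ ?_
    rintro _ ⟨w, hw, rfl⟩
    exact le_wlenH_of_evalH_eq hde hw
end
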